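/- arXiv:2101.06237 — 2 statements merged into one kernel-verified Lean document; each statement's English description precedes it below -/
import Mathlib

section
/- (Theorem 1, exact sample likelihood under a lognormal conditional model.) Let p : ℝ → [0,∞) be a probability density, h₁ : ℝ → ℝ measurable, h₂ ∈ ℝ, σ > 0, and suppose M := ∫_ℝ exp(h₁(y)) p(y) dy is finite and strictly positive. Define the joint population density f(y, π) = lognormalPDF(π; h₁(y) + h₂, σ²) · p(y) and the normalizing constant Z = ∫_ℝ ∫₀^∞ π f(y, π) dπ dy. Then Z = exp(h₂ + σ²/2) · M, and for every y ∈ ℝ and π > 0 the size-biased (in-sample) density satisfies π f(y, π)/Z = [φ(log π; h₁(y) + h₂, σ²) / (exp(h₂ + σ²/2) · M)] · p(y), where φ is the normal density. -/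
open MeasureTheory Real

/-- The lognormal probability density with parameters `μ` and `σ²`. -/
noncomputable def lognormalPDF (μ σ x : ℝ) : ℝ :=
  if 0 < x then (x * σ * Real.sqrt (2 * Real.pi))⁻¹ *
    Real.exp (-(Real.log x - μ) ^ 2 / (2 * σ ^ 2)) else 0

/-- The normal probability density with mean `μ` and variance `σ²`. -/
noncomputable def normalPDF (μ σ t : ℝ) : ℝ :=
  (σ * Real.sqrt (2 * Real.pi))⁻¹ * Real.exp (-(t - μ) ^ 2 / (2 * σ ^ 2))

/-- The mean of the lognormal distribution. -/
theorem lognormal_mean_aux (μ σ : ℝ) (hσ : 0 < σ) :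
    ∫ t in Set.Ioi (0 : ℝ), t * lognormalPDF μ σ t = Real.exp (μ + σ ^ 2 / 2) := by
  have hv : (⟨σ ^ 2, sq_nonneg σ⟩ : NNReal) ≠ 0 := by
    intro h
    have h2 : σ ^ 2 = 0 := congrArg NNReal.toReal h
    exact absurd h2 (by positivity)
  have himg : Real.exp '' Set.univ = Set.Ioi (0 : ℝ) := by
    rw [Set.image_univ, Real.range_exp]
  rw [← himg, integral_image_eq_integral_abs_deriv_smul MeasurableSet.univ
    (fun x _ => (Real.hasDerivAt_exp x).hasDerivWithinAt) Real.exp_injective.injOn,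
    Measure.restrict_univ]
  have hfun : ∀ x : ℝ, |Real.exp x| • (Real.exp x * lognormalPDF μ σ (Real.exp x)) =
      Real.exp (μ + σ ^ 2 / 2) *
        ProbabilityTheory.gaussianPDFReal (μ + σ ^ 2) ⟨σ ^ 2, sq_nonneg σ⟩ x := by
    intro x
    have hs : Real.sqrt (2 * Real.pi * σ ^ 2) = σ * Real.sqrt (2 * Real.pi) := by
      rw [Real.sqrt_mul (by positivity), Real.sqrt_sq hσ.le, mul_comm]
    have he : Real.exp x * Real.exp (-(x - μ) ^ 2 / (2 * σ ^ 2)) =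
        Real.exp (μ + σ ^ 2 / 2) * Real.exp (-(x - (μ + σ ^ 2)) ^ 2 / (2 * σ ^ 2)) := by
      rw [← Real.exp_add, ← Real.exp_add]
      congr 1
      field_simp
      ring
    have hx := Real.exp_pos x
    have hc : Real.exp x * (Real.exp x * σ * Real.sqrt (2 * Real.pi))⁻¹ =
        (σ * Real.sqrt (2 * Real.pi))⁻¹ := by
      field_simp
    simp only [ProbabilityTheory.gaussianPDFReal, lognormalPDF, hx, if_true, Real.log_exp,
      abs_of_pos hx, smul_eq_mul]
    rw [← mul_assoc (Real.exp x) (_)⁻¹, hc, mul_left_comm, he, mul_left_comm, ← hs]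
    rfl
  simp_rw [hfun]
  rw [integral_const_mul, ProbabilityTheory.integral_gaussianPDFReal_eq_one _ hv, mul_one]

/-- Theorem 1 (exact sample likelihood under a lognormal conditional model):
with joint population density `f(y, t) = lognormalPDF(t; h₁(y) + h₂, σ²) p(y)` and
normalizing constant `Z = ∫ ∫₀^∞ t f(y,t) dt dy`, we have `Z = exp(h₂ + σ²/2) M` and
the size-biased density `t f(y,t)/Z` equals
`[φ(log t; h₁(y) + h₂, σ²) / (exp(h₂ + σ²/2) M)] p(y)` for `t > 0`. -/
theorem exact_sample_likelihood_lognormal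
    (p : ℝ → ℝ) (hp_meas : Measurable p) (hp_nonneg : ∀ y, 0 ≤ p y)
    (hp_one : ∫ y, p y = 1)
    (h₁ : ℝ → ℝ) (hh₁ : Measurable h₁) (h₂ σ : ℝ) (hσ : 0 < σ)
    (M : ℝ) (hM : M = ∫ y, Real.exp (h₁ y) * p y)
    (hM_fin : Integrable (fun y => Real.exp (h₁ y) * p y)) (hM_pos : 0 < M)
    (f : ℝ → ℝ → ℝ) (hf : ∀ y t, f y t = lognormalPDF (h₁ y + h₂) σ t * p y)
    (Z : ℝ) (hZ : Z = ∫ y, ∫ t in Set.Ioi (0 : ℝ), t * f y t) :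
    Z = Real.exp (h₂ + σ ^ 2 / 2) * M ∧
      ∀ y t, 0 < t →
        t * f y t / Z =
          normalPDF (h₁ y + h₂) σ (Real.log t) / (Real.exp (h₂ + σ ^ 2 / 2) * M) * p y := by
  have hZM : Z = Real.exp (h₂ + σ ^ 2 / 2) * M := by
    rw [hZ, hM, ← integral_const_mul]
    congr 1
    funext y
    simp_rw [hf, ← mul_assoc]
    rw [integral_mul_const, lognormal_mean_aux _ _ hσ, ← Real.exp_add]
    congr 2
    ring
  refine ⟨hZM, fun y t ht => ?_⟩
  rw [hf, hZM]
  simp only [lognormalPDF, normalPDF, ht, if_true]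
  have hs : 0 < Real.sqrt (2 * Real.pi) := by positivity
  field_simp
end

section
/- Let m ∈ ℝ, σ_y > 0 (Gaussian response model with mean m = x'β + η^y and variance σ_y²), κ_y ∈ ℝ, c ∈ ℝ (lognormal location offset c = x'κ + η^π) and σ_π > 0. Then the normalizing constant of the linear-regression exact sample likelihood satisfies ∫_ℝ ∫₀^∞ π · lognormalPDF(π; κ_y y + c, σ_π²) · φ(y; m, σ_y²) dπ dy = exp(c + σ_π²/2 + κ_y m + κ_y² σ_y²/2). -/
open MeasureTheory Real

lemma normalPDF_integral (m s : ℝ) (hs : 0 < s) : ∫ y, normalPDF m s y = 1 := by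
  have h := ProbabilityTheory.integral_gaussianPDFReal_eq_one m
    (v := Real.toNNReal (s ^ 2)) (by
      have : 0 < s ^ 2 := by positivity
      exact (Real.toNNReal_pos.mpr this).ne')
  rw [← h]
  congr 1
  funext y
  unfold normalPDF ProbabilityTheory.gaussianPDFReal
  rw [Real.coe_toNNReal _ (sq_nonneg s)]
  rw [Real.sqrt_mul (by positivity) (s ^ 2), Real.sqrt_sq hs.le, mul_comm s]

lemma exp_mul_normalPDF_integral (k m s : ℝ) (hs : 0 < s) :
    ∫ y, Real.exp (k * y) * normalPDF m s y = Real.exp (k * m + k ^ 2 * s ^ 2 / 2) := by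
  have h : ∀ y, Real.exp (k * y) * normalPDF m s y
      = Real.exp (k * m + k ^ 2 * s ^ 2 / 2) * normalPDF (m + k * s ^ 2) s y := by
    intro y
    unfold normalPDF
    rw [mul_left_comm, mul_left_comm (Real.exp (k * m + _)), ← Real.exp_add, ← Real.exp_add]
    congr 2
    field_simp
    ring
  simp_rw [h]
  rw [integral_const_mul, normalPDF_integral _ _ hs, mul_one]

lemma lognormal_mean (μ s : ℝ) (hs : 0 < s) :
    ∫ t in Set.Ioi (0 : ℝ), t * lognormalPDF μ s t = Real.exp (μ + s ^ 2 / 2) := by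
  have h := integral_image_eq_integral_abs_deriv_smul (s := Set.univ) (f := Real.exp)
    (f' := Real.exp) MeasurableSet.univ
    (fun x _ => (Real.hasDerivAt_exp x).hasDerivWithinAt)
    Real.exp_injective.injOn (fun t => t * lognormalPDF μ s t)
  rw [Set.image_univ, Real.range_exp, setIntegral_univ] at h
  rw [h]
  have e := exp_mul_normalPDF_integral 1 μ s hs
  simp only [one_mul, one_pow] at e
  rw [← e]
  congr 1
  funext y
  unfold normalPDF lognormalPDF
  rw [if_pos (Real.exp_pos y), Real.log_exp, abs_of_pos (Real.exp_pos y), smul_eq_mul]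
  have := (Real.exp_pos y).ne'
  field_simp

/-- Normalizing constant of the linear-regression exact sample likelihood:
`∫ ∫₀^∞ t · lognormalPDF(t; κ_y y + c, σ_π²) · φ(y; m, σ_y²) dt dy`
`= exp(c + σ_π²/2 + κ_y m + κ_y² σ_y²/2)`. -/
theorem linear_regression_normalizing_constant
    (m σy κy c σπ : ℝ) (hσy : 0 < σy) (hσπ : 0 < σπ) :
    ∫ y, ∫ t in Set.Ioi (0 : ℝ),
        t * lognormalPDF (κy * y + c) σπ t * normalPDF m σy y
      = Real.exp (c + σπ ^ 2 / 2 + κy * m + κy ^ 2 * σy ^ 2 / 2) := by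
  simp_rw [integral_mul_const, lognormal_mean _ _ hσπ]
  have h : ∀ y, Real.exp (κy * y + c + σπ ^ 2 / 2) * normalPDF m σy y
      = Real.exp (c + σπ ^ 2 / 2) * (Real.exp (κy * y) * normalPDF m σy y) := by
    intro y
    rw [← mul_assoc, ← Real.exp_add]
    congr 2
    ring
  simp_rw [h]
  rw [integral_const_mul, exp_mul_normalPDF_integral _ _ _ hσy, ← Real.exp_add]
  congr 1
  ring
end
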